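/- arXiv:1910.06509 — 2 statements merged into one kernel-verified Lean document; each statement's English description precedes it below -/
import Mathlib

section
/- For the path graph P_n on n ≥ 2 vertices, the normalized influence score of each endpoint equals 3/(2(2n−1)) and the normalized influence score of each interior vertex equals 2/(2n−1). -/
open Finset

/-- Number of connected components of the subgraph of `G` induced on the finite
vertex set `C` (this is `0` when `C = ∅`). -/
noncomputable def betti {V : Type*} (G : SimpleGraph V) (C : Finset V) : ℕ :=
  Nat.card ((SimpleGraph.induce (↑C : Set V) G).ConnectedComponent)

/-- The Shapley influence value
`s(v) = Σ_{C ⊆ V∖{v}} (|C|!·(n−|C|−1)!/n!)·|β(C∪{v}) − β(C)|`. -/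
noncomputable def shapley {V : Type*} [Fintype V] [DecidableEq V]
    (G : SimpleGraph V) (v : V) : ℝ :=
  ∑ C ∈ (Finset.univ.erase v).powerset,
    ((C.card.factorial : ℝ) * ((Fintype.card V - C.card - 1).factorial : ℝ)
        / ((Fintype.card V).factorial : ℝ)) *
      |((betti G (insert v C) : ℝ)) - ((betti G C : ℝ))|

/-- Normalized influence score `μ(v) = s(v) / Σ_u s(u)`. -/
noncomputable def influence {V : Type*} [Fintype V] [DecidableEq V]
    (G : SimpleGraph V) (v : V) : ℝ :=
  shapley G v / ∑ u : V, shapley G u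

/-- Entropy `H(G) = −Σ_v μ(v)·log μ(v)`. -/
noncomputable def graphEntropy {V : Type*} [Fintype V] [DecidableEq V]
    (G : SimpleGraph V) : ℝ :=
  -∑ v : V, influence G v * Real.log (influence G v)

/-- The path graph on `Fin n`: `i` adjacent to `j` iff `|i − j| = 1`. -/
def pathGraph (n : ℕ) : SimpleGraph (Fin n) :=
  SimpleGraph.fromRel (fun i j => i.val + 1 = j.val)

/-- A discrete beta integral over the subsets of a finite set. -/
theorem sum_powerset_factorial_mul_factorial {α : Type*} [DecidableEq α] (T : Finset α) (p q : ℕ) :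
    ∑ C ∈ T.powerset, ((C.card + p).factorial : ℝ) * ((T.card - C.card + q).factorial : ℝ) =
      p.factorial * q.factorial * (T.card + p + q + 1).factorial / (p + q + 1).factorial := by
  induction T using Finset.induction_on generalizing p q with
  | empty => simp; field_simp
  | insert a T ha ih =>
    rw [Finset.sum_powerset_insert ha, Finset.card_insert_of_notMem ha]
    have h₁ : ∀ C ∈ T.powerset,
        ((C.card + p).factorial : ℝ) * ((T.card + 1 - C.card + q).factorial : ℝ) =
          ((C.card + p).factorial : ℝ) * ((T.card - C.card + (q + 1)).factorial : ℝ) := by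
      intro C hC
      have := Finset.card_le_card (Finset.mem_powerset.1 hC)
      congr 3
      omega
    have h₂ : ∀ C ∈ T.powerset,
        (((insert a C).card + p).factorial : ℝ) *
            ((T.card + 1 - (insert a C).card + q).factorial : ℝ) =
          ((C.card + (p + 1)).factorial : ℝ) * ((T.card - C.card + q).factorial : ℝ) := by
      intro C hC
      rw [Finset.card_insert_of_notMem fun h => ha (Finset.mem_powerset.1 hC h)]
      congr 3 <;> omega
    rw [Finset.sum_congr rfl h₁, Finset.sum_congr rfl h₂, ih, ih,
      show T.card + p + (q + 1) + 1 = T.card + 1 + p + q + 1 by omega,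
      show T.card + (p + 1) + q + 1 = T.card + 1 + p + q + 1 by omega,
      show p + (q + 1) + 1 = p + q + 1 + 1 by omega,
      show p + 1 + q + 1 = p + q + 1 + 1 by omega,
      Nat.factorial_succ (p + q + 1), Nat.factorial_succ p, Nat.factorial_succ q]
    push_cast
    field_simp
    ring

theorem pathGraph_adj {n : ℕ} {i j : Fin n} :
    (pathGraph n).Adj i j ↔ i.val + 1 = j.val ∨ j.val + 1 = i.val := by
  simp only [pathGraph, SimpleGraph.fromRel_adj, ne_eq, Fin.ext_iff]
  omega

/-- The vertices of `C` whose predecessor is not in `C`. -/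
def leftEnds {n : ℕ} (C : Finset (Fin n)) : Finset (Fin n) :=
  C.filter fun i => ∀ j ∈ C, j.val + 1 ≠ i.val

theorem mem_leftEnds {n : ℕ} {C : Finset (Fin n)} {i : Fin n} :
    i ∈ leftEnds C ↔ i ∈ C ∧ ∀ j ∈ C, j.val + 1 ≠ i.val := by
  simp [leftEnds]

theorem exists_leftEnds_reachable {n : ℕ} (C : Finset (Fin n)) (k : ℕ) :
    ∀ i : (↑C : Set (Fin n)), i.1.val = k → ∃ l : (↑C : Set (Fin n)), l.1 ∈ leftEnds C ∧
      (SimpleGraph.induce (↑C : Set (Fin n)) (pathGraph n)).Reachable l i := by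
  induction k with
  | zero =>
    intro i hi
    exact ⟨i, mem_leftEnds.2 ⟨i.2, fun j _ => by omega⟩, .refl _⟩
  | succ k ih =>
    intro i hi
    by_cases h : ∃ j ∈ C, j.val + 1 = i.1.val
    · obtain ⟨j, hj, hji⟩ := h
      obtain ⟨l, hl, hlj⟩ := ih ⟨j, hj⟩ (by simp only; omega)
      refine ⟨l, hl, hlj.trans (SimpleGraph.Adj.reachable ?_)⟩
      exact pathGraph_adj.2 (.inl hji)
    · push Not at h
      exact ⟨i, mem_leftEnds.2 ⟨i.2, h⟩, .refl _⟩

theorem filter_leftEnds_eq_of_succ {n : ℕ} {C : Finset (Fin n)} {i j : Fin n} (hi : i ∈ C)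
    (h : i.val + 1 = j.val) :
    (leftEnds C).filter (· ≤ i) = (leftEnds C).filter (· ≤ j) := by
  ext l
  simp only [Finset.mem_filter, and_congr_right_iff, Fin.le_def]
  intro hl
  have := (mem_leftEnds.1 hl).2 i hi
  omega

theorem filter_leftEnds_eq_of_reachable {n : ℕ} {C : Finset (Fin n)} {i j : (↑C : Set (Fin n))}
    (h : (SimpleGraph.induce (↑C : Set (Fin n)) (pathGraph n)).Reachable i j) :
    (leftEnds C).filter (· ≤ i.1) = (leftEnds C).filter (· ≤ j.1) := by
  obtain ⟨w⟩ := h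
  induction w with
  | nil => rfl
  | @cons u v _ h _ ih =>
    rw [← ih]
    rcases pathGraph_adj.1 (show (pathGraph n).Adj u.1 v.1 from h) with h | h
    · exact filter_leftEnds_eq_of_succ u.2 h
    · exact (filter_leftEnds_eq_of_succ v.2 h).symm

theorem betti_pathGraph {n : ℕ} (C : Finset (Fin n)) :
    betti (pathGraph n) C = (leftEnds C).card := by
  have hsub : ∀ l : leftEnds C, l.1 ∈ (↑C : Set (Fin n)) := fun l => (mem_leftEnds.1 l.2).1
  let f : leftEnds C →
      (SimpleGraph.induce (↑C : Set (Fin n)) (pathGraph n)).ConnectedComponent :=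
    fun l => SimpleGraph.connectedComponentMk _ ⟨l.1, hsub l⟩
  have hf : Function.Bijective f := by
    constructor
    · intro l l' h
      have h' := filter_leftEnds_eq_of_reachable (SimpleGraph.ConnectedComponent.exact h)
      have h₁ : l.1 ∈ (leftEnds C).filter (· ≤ l'.1) := by
        rw [← h']; simp
      have h₂ : l'.1 ∈ (leftEnds C).filter (· ≤ l.1) := by
        rw [h']; simp
      exact Subtype.ext (le_antisymm (Finset.mem_filter.1 h₁).2 (Finset.mem_filter.1 h₂).2)
    · intro c
      induction c using SimpleGraph.ConnectedComponent.ind with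
      | h i =>
        obtain ⟨l, hl, hli⟩ := exists_leftEnds_reachable C _ i rfl
        exact ⟨⟨l.1, hl⟩, SimpleGraph.ConnectedComponent.sound hli⟩
  rw [betti, ← Nat.card_eq_of_bijective f hf]
  simp

theorem leftEnds_insert {n : ℕ} (C : Finset (Fin n)) (v : Fin n) :
    leftEnds (insert v C) =
      (if ∃ j ∈ C, j.val + 1 = v.val then ∅ else {v}) ∪
        (leftEnds C).filter fun j => v.val + 1 ≠ j.val := by
  ext i
  simp only [mem_leftEnds, Finset.mem_insert, Finset.mem_union, Finset.mem_filter,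
    forall_eq_or_imp]
  split_ifs with h
  · obtain ⟨j, hj, hjv⟩ := h
    simp only [Finset.notMem_empty, false_or]
    constructor
    · rintro ⟨rfl | hi, h₁, h₂⟩
      · exact absurd hjv (h₂ j hj)
      · exact ⟨⟨hi, h₂⟩, h₁⟩
    · rintro ⟨⟨hi, h₂⟩, h₁⟩
      exact ⟨.inr hi, h₁, h₂⟩
  · push Not at h
    rw [Finset.mem_singleton]
    constructor
    · rintro ⟨rfl | hi, h₁, h₂⟩
      · exact .inl rfl
      · exact .inr ⟨⟨hi, h₂⟩, h₁⟩
    · rintro (rfl | ⟨⟨hi, h₂⟩, h₁⟩)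
      · exact ⟨.inl rfl, by omega, h⟩
      · exact ⟨.inr hi, h₁, h₂⟩

theorem card_filter_leftEnds_succ {n : ℕ} {C : Finset (Fin n)} {v : Fin n} (hv : v ∉ C) :
    ((leftEnds C).filter fun j => v.val + 1 = j.val).card =
      if ∃ j ∈ C, v.val + 1 = j.val then 1 else 0 := by
  split_ifs with h
  · obtain ⟨j, hj, hvj⟩ := h
    rw [Finset.card_eq_one]
    refine ⟨j, Finset.ext fun i => ?_⟩
    rw [Finset.mem_filter, Finset.mem_singleton, mem_leftEnds]
    constructor
    · rintro ⟨-, hi⟩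
      exact Fin.ext (by omega)
    · rintro rfl
      refine ⟨⟨hj, fun k hk hki => hv ?_⟩, hvj⟩
      rwa [show v = k from Fin.ext (by omega)]
  · rw [Finset.card_eq_zero, Finset.filter_eq_empty_iff]
    exact fun j hj hvj => h ⟨j, (mem_leftEnds.1 hj).1, hvj⟩

theorem betti_pathGraph_insert_sub {n : ℕ} {C : Finset (Fin n)} {v : Fin n} (hv : v ∉ C) :
    (betti (pathGraph n) (insert v C) : ℝ) - betti (pathGraph n) C =
      (if ∃ j ∈ C, j.val + 1 = v.val then 0 else 1) -
        (if ∃ j ∈ C, v.val + 1 = j.val then 1 else 0) := by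
  have hL : v ∉ leftEnds C := fun h => hv (mem_leftEnds.1 h).1
  have hcard : (leftEnds (insert v C)).card =
      (if ∃ j ∈ C, j.val + 1 = v.val then 0 else 1) +
        ((leftEnds C).filter fun j => v.val + 1 ≠ j.val).card := by
    rw [leftEnds_insert, Finset.card_union_of_disjoint]
    · split_ifs <;> simp
    · split_ifs <;> simp [hL]
  have hsplit := Finset.card_filter_add_card_filter_not (s := leftEnds C)
    (fun j => v.val + 1 = j.val)
  rw [card_filter_leftEnds_succ hv] at hsplit
  rw [betti_pathGraph, betti_pathGraph, hcard, ← hsplit]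
  push_cast
  ring

theorem shapley_eq_half {V : Type*} [Fintype V] [DecidableEq V] {G : SimpleGraph V} {v a : V}
    (hav : a ≠ v)
    (h : ∀ C : Finset V, v ∉ C →
      |(betti G (insert v C) : ℝ) - betti G C| = if a ∈ C then 0 else 1) :
    shapley G v = 1 / 2 := by
  set T : Finset V := (univ.erase v).erase a with hT
  have ha : a ∉ T := Finset.notMem_erase _ _
  have haT : insert a T = univ.erase v := Finset.insert_erase (by simp [hav])
  have hvT : v ∉ insert a T := by simp [haT]
  have hn : Fintype.card V = T.card + 2 := by
    rw [← Finset.card_univ, ← Finset.insert_erase (Finset.mem_univ v), ← haT,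
      Finset.card_insert_of_notMem hvT, Finset.card_insert_of_notMem ha]
  have hsum : shapley G v = ∑ C ∈ T.powerset,
      (((C.card + 0).factorial : ℝ) * ((T.card - C.card + 1).factorial : ℝ)) /
        (T.card + 2).factorial := by
    rw [shapley, ← haT, Finset.sum_powerset_insert ha, hn]
    rw [Finset.sum_eq_zero (s := T.powerset)
        (f := fun C => _ * |(betti G (insert v (insert a C)) : ℝ) - _|),
      add_zero]
    · refine Finset.sum_congr rfl fun C hC => ?_
      have hC := Finset.mem_powerset.1 hC
      have hcard := Finset.card_le_card hC
      rw [h C fun hv => hvT (Finset.mem_insert_of_mem (hC hv)), if_neg fun h => ha (hC h), mul_one,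
        add_zero, show T.card + 2 - C.card - 1 = T.card - C.card + 1 by omega]
    · intro C hC
      rw [h _ fun hv => hvT (Finset.insert_subset_insert _ (Finset.mem_powerset.1 hC) hv),
        if_pos (Finset.mem_insert_self _ _), mul_zero]
  rw [hsum, ← Finset.sum_div, sum_powerset_factorial_mul_factorial]
  simp only [add_zero, zero_add, add_assoc, Nat.reduceAdd]
  field_simp
  norm_num [Nat.factorial]

theorem shapley_eq_two_thirds {V : Type*} [Fintype V] [DecidableEq V] {G : SimpleGraph V}
    {v a b : V} (hav : a ≠ v) (hbv : b ≠ v) (hab : a ≠ b)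
    (h : ∀ C : Finset V, v ∉ C →
      |(betti G (insert v C) : ℝ) - betti G C| = if a ∈ C ↔ b ∈ C then 1 else 0) :
    shapley G v = 2 / 3 := by
  set T : Finset V := ((univ.erase v).erase a).erase b with hT
  have hb : b ∉ T := Finset.notMem_erase _ _
  have ha : a ∉ insert b T := by simp [hT, hab]
  have haT : insert a (insert b T) = univ.erase v := by
    rw [Finset.insert_erase (by simp [hbv, hab.symm]), Finset.insert_erase (by simp [hav])]
  have hvT : v ∉ insert a (insert b T) := by simp [haT]
  have hn : Fintype.card V = T.card + 3 := by
    rw [← Finset.card_univ, ← Finset.insert_erase (Finset.mem_univ v), ← haT,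
      Finset.card_insert_of_notMem hvT, Finset.card_insert_of_notMem ha,
      Finset.card_insert_of_notMem hb]
  have hsum : shapley G v =
      ∑ C ∈ T.powerset, (((C.card + 0).factorial : ℝ) * ((T.card - C.card + 2).factorial : ℝ)) /
          (T.card + 3).factorial +
        ∑ C ∈ T.powerset, (((C.card + 2).factorial : ℝ) * ((T.card - C.card + 0).factorial : ℝ)) /
          (T.card + 3).factorial := by
    rw [shapley, ← haT, Finset.sum_powerset_insert ha, Finset.sum_powerset_insert hb,
      Finset.sum_powerset_insert hb, hn, ← Finset.sum_add_distrib, ← Finset.sum_add_distrib,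
      ← Finset.sum_add_distrib, ← Finset.sum_add_distrib]
    refine Finset.sum_congr rfl fun C hC => ?_
    have hC := Finset.mem_powerset.1 hC
    have hcard := Finset.card_le_card hC
    have haC : a ∉ C := fun h => ha (Finset.mem_insert_of_mem (hC h))
    have hbC : b ∉ C := fun h => hb (hC h)
    have hvC : v ∉ C := fun h => hvT (Finset.mem_insert_of_mem (Finset.mem_insert_of_mem (hC h)))
    have habC : a ∉ insert b C := by simp [hab, haC]
    rw [h C hvC, h (insert b C) (by simp [hbv.symm, hvC]), h (insert a C) (by simp [hav.symm, hvC]),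
      h (insert a (insert b C)) (by simp [hav.symm, hbv.symm, hvC]),
      Finset.card_insert_of_notMem habC, Finset.card_insert_of_notMem hbC,
      show T.card + 3 - C.card - 1 = T.card - C.card + 2 by omega,
      show T.card + 3 - (C.card + 1 + 1) - 1 = T.card - C.card by omega]
    simp [haC, hbC, hab, hab.symm]
  rw [hsum, ← Finset.sum_div, ← Finset.sum_div, sum_powerset_factorial_mul_factorial,
    sum_powerset_factorial_mul_factorial]
  simp only [add_zero, zero_add, add_assoc, Nat.reduceAdd]
  field_simp
  norm_num [Nat.factorial]

theorem exists_mem_iff {n : ℕ} {C : Finset (Fin n)} {p : Fin n → Prop} {a : Fin n}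
    (h : ∀ j, p j ↔ j = a) : (∃ j ∈ C, p j) ↔ a ∈ C := by
  simp [h]

theorem shapley_pathGraph_zero {m : ℕ} : shapley (pathGraph (m + 2)) 0 = 1 / 2 := by
  refine shapley_eq_half (a := 1) (by simp) fun C hC => ?_
  rw [betti_pathGraph_insert_sub hC, if_neg (by simp),
    if_congr (exists_mem_iff (a := 1) fun j => by simp [Fin.ext_iff, eq_comm]) rfl rfl]
  split_ifs <;> simp

theorem shapley_pathGraph_last {m : ℕ} :
    shapley (pathGraph (m + 2)) (Fin.last (m + 1)) = 1 / 2 := by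
  refine shapley_eq_half (a := (Fin.last m).castSucc) (by simp [Fin.ext_iff]) fun C hC => ?_
  rw [betti_pathGraph_insert_sub hC,
    if_neg (c := ∃ j ∈ C, (Fin.last (m + 1)).val + 1 = j.val)
      (by rintro ⟨j, -, hj⟩; have := j.2; simp at hj; omega),
    if_congr (exists_mem_iff (a := (Fin.last m).castSucc) fun j => by simp [Fin.ext_iff]) rfl rfl]
  split_ifs <;> simp

theorem shapley_pathGraph_interior {m : ℕ} (i : Fin m) :
    shapley (pathGraph (m + 2)) i.succ.castSucc = 2 / 3 := by
  refine shapley_eq_two_thirds (a := i.castSucc.castSucc) (b := i.succ.succ)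
    (by simp [Fin.ext_iff]) (by simp [Fin.ext_iff]) (by simp [Fin.ext_iff]; omega) fun C hC => ?_
  rw [betti_pathGraph_insert_sub hC,
    if_congr (exists_mem_iff (a := i.castSucc.castSucc) fun j => by simp [Fin.ext_iff]) rfl rfl,
    if_congr (exists_mem_iff (a := i.succ.succ) fun j => by simp [Fin.ext_iff, eq_comm]) rfl rfl]
  by_cases h₁ : i.castSucc.castSucc ∈ C <;> by_cases h₂ : i.succ.succ ∈ C <;> simp [h₁, h₂]

theorem sum_shapley_pathGraph (m : ℕ) :
    ∑ u, shapley (pathGraph (m + 2)) u = (2 * ((m + 2 : ℕ) : ℝ) - 1) / 3 := by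
  rw [Fin.sum_univ_castSucc, Fin.sum_univ_succ, Fin.castSucc_zero, shapley_pathGraph_zero,
    shapley_pathGraph_last]
  simp only [shapley_pathGraph_interior, Finset.sum_const, Finset.card_univ, Fintype.card_fin,
    nsmul_eq_mul]
  push_cast
  ring

/-- For the path graph `P_n` on `n ≥ 2` vertices, the normalized influence
score of each endpoint equals `3/(2(2n−1))` and the normalized influence score
of each interior vertex equals `2/(2n−1)`. -/
theorem influence_pathGraph (n : ℕ) (hn : 2 ≤ n) (v : Fin n) :
    (v.val = 0 ∨ v.val = n - 1 →
      influence (pathGraph n) v = 3 / (2 * (2 * (n : ℝ) - 1))) ∧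
    (0 < v.val ∧ v.val < n - 1 →
      influence (pathGraph n) v = 2 / (2 * (n : ℝ) - 1)) := by
  obtain ⟨m, rfl⟩ := Nat.exists_eq_add_of_le' hn
  have hpos : (2 * ((m + 2 : ℕ) : ℝ) - 1) ≠ 0 := by
    apply ne_of_gt
    have : (0 : ℝ) ≤ m := m.cast_nonneg
    push_cast
    linarith
  refine ⟨fun hv => ?_, fun ⟨h₀, h₁⟩ => ?_⟩
  · have hs : shapley (pathGraph (m + 2)) v = 1 / 2 := by
      rcases hv with hv | hv
      · rw [show v = 0 from Fin.ext hv, shapley_pathGraph_zero]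
      · rw [show v = Fin.last (m + 1) from Fin.ext hv, shapley_pathGraph_last]
    rw [influence, sum_shapley_pathGraph, hs]
    field_simp
  · have hv : v = (Fin.succ ⟨v.val - 1, by omega⟩ : Fin (m + 1)).castSucc :=
      Fin.ext (by simp; omega)
    rw [influence, sum_shapley_pathGraph, hv, shapley_pathGraph_interior]
    field_simp
end

section
/- For the wheel graph W_n on n ≥ 4 vertices, the normalized influence score of every periphery vertex equals 2(n² − n − 3)/(3(n−1)(n² − 3n + 4)) and the normalized influence score of the center equals (n² − 7n + 18)/(3(n² − 3n + 4)). -/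
open Finset

/-- The wheel graph with `m` periphery vertices (a cycle on `Fin m`) and a
center `none` adjacent to every periphery vertex; it has `m + 1` vertices. -/
def wheelGraph (m : ℕ) : SimpleGraph (Option (Fin m)) :=
  SimpleGraph.fromRel (fun a b =>
    a = none ∨ ∃ i j, a = some i ∧ b = some j ∧ (i.val + 1) % m = j.val)

/-- A vertex set in which every vertex can be joined to a fixed one has one component. -/
lemma betti_eq_one {V : Type*} {G : SimpleGraph V} {C : Finset V} (v : V) (hv : v ∈ C)
    (h : ∀ u, ∀ hu : u ∈ C,
      (SimpleGraph.induce (↑C : Set V) G).Reachable ⟨v, hv⟩ ⟨u, hu⟩) :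
    betti G C = 1 := by
  unfold betti
  rw [Nat.card_eq_one_iff_exists]
  refine ⟨SimpleGraph.connectedComponentMk _ ⟨v, hv⟩, fun y => ?_⟩
  induction y using SimpleGraph.ConnectedComponent.ind with
  | _ u => exact SimpleGraph.ConnectedComponent.sound (h u.1 u.2).symm

lemma betti_empty {V : Type*} (G : SimpleGraph V) : betti G ∅ = 0 := by
  unfold betti
  rw [Nat.card_eq_zero]
  left
  refine ⟨fun y => ?_⟩
  induction y using SimpleGraph.ConnectedComponent.ind with
  | _ u => exact absurd u.2 (by simp)

lemma wheelGraph_adj_none {m : ℕ} (i : Fin m) : (wheelGraph m).Adj none (some i) := by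
  simp [wheelGraph]

lemma wheelGraph_adj_some {m : ℕ} [NeZero m] (i j : Fin m) :
    (wheelGraph m).Adj (some i) (some j) ↔ i ≠ j ∧ (j = i + 1 ∨ i = j + 1) := by
  have h : ∀ a b : Fin m, (a.val + 1) % m = b.val ↔ b = a + 1 := fun a b => by
    rw [Fin.ext_iff, Fin.val_add, Fin.val_one', Nat.add_mod_mod, eq_comm]
  simp [wheelGraph, h]

lemma Fin.self_ne_add_one {m : ℕ} [NeZero m] (hm : 2 ≤ m) (i : Fin m) : i ≠ i + 1 := by
  intro h
  have h1 : (1 : Fin m) = 0 := by simpa using h.symm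
  have h2 := congrArg Fin.val h1
  rw [Fin.val_one', Nat.mod_eq_of_lt (by omega)] at h2
  simp at h2

lemma betti_wheelGraph_of_none_mem {m : ℕ} {C : Finset (Option (Fin m))} (h : none ∈ C) :
    betti (wheelGraph m) C = 1 := by
  refine betti_eq_one none h fun u hu => ?_
  rcases u with _ | i
  · exact SimpleGraph.Reachable.refl _
  · exact SimpleGraph.Adj.reachable (by simpa using wheelGraph_adj_none i)

section arcs

open scoped Fin.CommRing

lemma betti_wheelGraph_periphery {m : ℕ} [NeZero m] (hm : 2 ≤ m) :
    betti (wheelGraph m) (univ.erase none) = 1 := by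
  have key : ∀ k : ℕ, (SimpleGraph.induce
      (↑((univ : Finset (Option (Fin m))).erase none) : Set (Option (Fin m)))
      (wheelGraph m)).Reachable ⟨some 0, by simp⟩ ⟨some (k : Fin m), by simp⟩ := by
    intro k
    induction k with
    | zero => simp
    | succ k ih =>
      refine ih.trans (SimpleGraph.Adj.reachable ?_)
      simpa [wheelGraph_adj_some] using Fin.self_ne_add_one hm (k : Fin m)
  refine betti_eq_one (some 0) (by simp) fun u hu => ?_
  rcases u with _ | i
  · simp at hu
  · simpa using key i.val

/-- The last vertex of the arc of `C` that contains `i`, in the direction of `· + 1`. -/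
noncomputable def arcEnd {m : ℕ} [NeZero m] {C : Finset (Option (Fin m))}
    (hC : ∀ i : Fin m, ∃ k : ℕ, some (i + k + 1) ∉ C) (i : Fin m) : Fin m :=
  i + (Nat.find (hC i) : Fin m)

section arcEnd

variable {m : ℕ} [NeZero m] {C : Finset (Option (Fin m))}
  (hC : ∀ i : Fin m, ∃ k : ℕ, some (i + k + 1) ∉ C)

lemma arcEnd_add_one_notMem (i : Fin m) : some (arcEnd hC i + 1) ∉ C :=
  Nat.find_spec (hC i)

lemma arcEnd_eq_self {i : Fin m} (h : some (i + 1) ∉ C) : arcEnd hC i = i := by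
  have : Nat.find (hC i) = 0 := by
    rw [Nat.find_eq_zero]
    simpa using h
  simp [arcEnd, this]

lemma arcEnd_add_one {i : Fin m} (h : some (i + 1) ∈ C) :
    arcEnd hC (i + 1) = arcEnd hC i := by
  have hs : ∃ k : ℕ, some (i + ((k + 1 : ℕ) : Fin m) + 1) ∉ C := by
    obtain ⟨k, hk⟩ := hC (i + 1)
    refine ⟨k, ?_⟩
    have : i + ((k + 1 : ℕ) : Fin m) + 1 = i + 1 + k + 1 := by push_cast; abel
    rwa [this]
  have h1 : Nat.find (hC i) = Nat.find hs + 1 :=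
    Nat.find_comp_succ (hC i) hs (by simpa using h)
  have h2 : Nat.find (hC (i + 1)) = Nat.find hs := by
    refine Nat.find_congr' fun {k} => ?_
    have : i + ((k + 1 : ℕ) : Fin m) + 1 = i + 1 + k + 1 := by push_cast; abel
    rw [this]
  unfold arcEnd
  rw [h1, h2]
  push_cast
  abel

lemma exists_reachable_arcEnd (hm : 2 ≤ m) {i : Fin m} (hi : some i ∈ C) :
    ∃ h : some (arcEnd hC i) ∈ C, (SimpleGraph.induce (↑C : Set (Option (Fin m)))
      (wheelGraph m)).Reachable ⟨some i, hi⟩ ⟨some (arcEnd hC i), h⟩ := by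
  have key : ∀ k : ℕ, k ≤ Nat.find (hC i) → ∃ h : some (i + (k : Fin m)) ∈ C,
      (SimpleGraph.induce (↑C : Set (Option (Fin m)))
        (wheelGraph m)).Reachable ⟨some i, hi⟩ ⟨some (i + (k : Fin m)), h⟩ := by
    intro k
    induction k with
    | zero => intro _; simpa using hi
    | succ k ih =>
      intro hk
      obtain ⟨h, hr⟩ := ih (by omega)
      have hmem : some (i + (k : Fin m) + 1) ∈ C := by
        simpa using Nat.find_min (hC i) (show k < Nat.find (hC i) by omega)
      have heq : i + ((k + 1 : ℕ) : Fin m) = i + (k : Fin m) + 1 := by push_cast; abel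
      simp only [heq]
      refine ⟨hmem, hr.trans (SimpleGraph.Adj.reachable ?_)⟩
      simpa [wheelGraph_adj_some] using Fin.self_ne_add_one hm (i + (k : Fin m))
  exact key _ le_rfl

end arcEnd

/-- A proper subset of the periphery has as many components as arc ends. -/
lemma betti_wheelGraph_of_proper {m : ℕ} [NeZero m] (hm : 2 ≤ m) {C : Finset (Option (Fin m))}
    (h0 : none ∉ C) (hp : ∃ j : Fin m, some j ∉ C) :
    betti (wheelGraph m) C = #{i : Fin m | some i ∈ C ∧ some (i + 1) ∉ C} := by
  have hC : ∀ i : Fin m, ∃ k : ℕ, some (i + k + 1) ∉ C := by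
    intro i
    obtain ⟨j, hj⟩ := hp
    refine ⟨(j - i - 1 : Fin m).val, ?_⟩
    have : i + (((j - i - 1 : Fin m).val : ℕ) : Fin m) + 1 = j := by
      rw [Fin.cast_val_eq_self]; abel
    rwa [this]
  have hsome : ∀ u : (↑C : Set (Option (Fin m))), ∃ i, u.1 = some i := by
    rintro ⟨_ | i, hu⟩
    · exact absurd hu h0
    · exact ⟨i, rfl⟩
  let e : (↑C : Set (Option (Fin m))) → Fin m := fun u => (u.1.map (arcEnd hC)).getD 0
  have he : ∀ i (hi : some i ∈ C), e ⟨some i, hi⟩ = arcEnd hC i := fun i hi => rfl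
  have hadj : ∀ u w, (SimpleGraph.induce (↑C : Set (Option (Fin m))) (wheelGraph m)).Adj u w →
      e u = e w := by
    rintro ⟨u, hu⟩ ⟨w, hw⟩ h
    obtain ⟨i, rfl⟩ := hsome ⟨u, hu⟩
    obtain ⟨j, rfl⟩ := hsome ⟨w, hw⟩
    have h' : (wheelGraph m).Adj (some i) (some j) := by simpa using h
    rw [he i hu, he j hw]
    rcases ((wheelGraph_adj_some i j).1 h').2 with rfl | rfl
    · exact (arcEnd_add_one hC hw).symm
    · exact arcEnd_add_one hC hu
  have hwalk : ∀ u w, (SimpleGraph.induce (↑C : Set (Option (Fin m)))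
      (wheelGraph m)).Reachable u w → e u = e w := by
    rintro u w ⟨p⟩
    induction p with
    | nil => rfl
    | cons h _ ih => exact (hadj _ _ h).trans ih
  unfold betti
  let f : {i : Fin m // i ∈ ({i : Fin m | some i ∈ C ∧ some (i + 1) ∉ C} : Finset (Fin m))} →
      (SimpleGraph.induce (↑C : Set (Option (Fin m))) (wheelGraph m)).ConnectedComponent :=
    fun i => SimpleGraph.connectedComponentMk _ ⟨some i.1, (Finset.mem_filter.1 i.2).2.1⟩
  have hf : Function.Bijective f := by
    constructor
    · rintro ⟨i, hi⟩ ⟨j, hj⟩ hij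
      have hij' := hwalk _ _ (SimpleGraph.ConnectedComponent.exact hij)
      rw [Finset.mem_filter] at hi hj
      rw [he i hi.2.1, he j hj.2.1, arcEnd_eq_self hC hi.2.2, arcEnd_eq_self hC hj.2.2] at hij'
      exact Subtype.ext hij'
    · intro y
      induction y using SimpleGraph.ConnectedComponent.ind with
      | _ u =>
        obtain ⟨u, hu⟩ := u
        obtain ⟨i, rfl⟩ := hsome ⟨u, hu⟩
        obtain ⟨h, hr⟩ := exists_reachable_arcEnd hC hm hu
        exact ⟨⟨arcEnd hC i, by simpa using ⟨h, arcEnd_add_one_notMem hC i⟩⟩,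
          SimpleGraph.ConnectedComponent.sound hr.symm⟩
  rw [← Nat.card_eq_of_bijective f hf, Nat.card_eq_finsetCard]

end arcs

/-- The probability weight of a coalition of size `k` among `n` players. -/
noncomputable def shapleyWeight (n k : ℕ) : ℝ :=
  (k.factorial : ℝ) * ((n - k - 1).factorial : ℝ) / (n.factorial : ℝ)

lemma shapleyWeight_add_succ {n k : ℕ} (h : k < n) :
    shapleyWeight (n + 1) k + shapleyWeight (n + 1) (k + 1) = shapleyWeight n k := by
  obtain ⟨d, rfl⟩ : ∃ d, n = k + d + 1 := ⟨n - k - 1, by omega⟩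
  unfold shapleyWeight
  rw [show k + d + 1 + 1 - k - 1 = d + 1 by omega, show k + d + 1 + 1 - (k + 1) - 1 = d by omega,
    show k + d + 1 - k - 1 = d by omega, Nat.factorial_succ (k + d + 1), Nat.factorial_succ d,
    Nat.factorial_succ k]
  have := Nat.factorial_ne_zero (k + d + 1)
  push_cast
  field_simp
  ring

lemma sum_powerset_shapleyWeight {V : Type*} [DecidableEq V] (R : Finset V) (a b : ℕ) :
    ∑ D ∈ R.powerset, shapleyWeight (#R + a + b + 1) (#D + a) = shapleyWeight (a + b + 1) a := by
  induction R using Finset.induction_on with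
  | empty => simp
  | insert x R hx ih =>
    rw [Finset.sum_powerset_insert hx, ← ih, ← Finset.sum_add_distrib]
    refine Finset.sum_congr rfl fun D hD => ?_
    have hD' := Finset.mem_powerset.1 hD
    rw [Finset.card_insert_of_notMem hx, Finset.card_insert_of_notMem fun h => hx (hD' h)]
    have := Finset.card_le_card hD'
    rw [← shapleyWeight_add_succ (n := #R + a + b + 1) (k := #D + a) (by omega)]
    congr 2 <;> ring

/-- The indicator of the coalitions that contain `A` and avoid `B`. -/
def cylinder {V : Type*} [DecidableEq V] (A B C : Finset V) : ℝ :=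
  if A ⊆ C ∧ Disjoint B C then 1 else 0

lemma sum_shapleyWeight_mul_cylinder {V : Type*} [DecidableEq V] {S A B : Finset V}
    (hA : A ⊆ S) (hB : B ⊆ S) (hAB : Disjoint A B) :
    ∑ C ∈ S.powerset, shapleyWeight (#S + 1) #C * cylinder A B C =
      shapleyWeight (#A + #B + 1) #A := by
  have hcard : #(S \ (A ∪ B)) + #A + #B = #S := by
    have h1 := Finset.card_sdiff_add_card_eq_card (Finset.union_subset hA hB)
    have h2 := Finset.card_union_of_disjoint hAB
    omega
  rw [← sum_powerset_shapleyWeight (S \ (A ∪ B)), hcard]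
  simp only [cylinder, mul_ite, mul_one, mul_zero]
  rw [← Finset.sum_filter]
  symm
  refine Finset.sum_bij' (fun D _ => D ∪ A) (fun C _ => C \ A) ?_ ?_ ?_ ?_ ?_
  · intro D hD
    rw [Finset.mem_powerset] at hD
    rw [Finset.mem_filter, Finset.mem_powerset]
    refine ⟨Finset.union_subset (hD.trans Finset.sdiff_subset) hA,
      Finset.subset_union_right, Finset.disjoint_union_right.2 ⟨?_, hAB.symm⟩⟩
    rw [Finset.disjoint_left]
    intro x hx hxD
    have := hD hxD
    simp [hx] at this
  · intro C hC
    simp only [Finset.mem_filter, Finset.mem_powerset] at hC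
    rw [Finset.mem_powerset]
    intro x hx
    rw [Finset.mem_sdiff] at hx
    have := Finset.disjoint_right.1 hC.2.2 hx.1
    simp [hx.2, this, hC.1 hx.1]
  · intro D hD
    rw [Finset.mem_powerset] at hD
    ext x
    have := @hD x
    simp only [Finset.mem_sdiff, Finset.mem_union] at this ⊢
    tauto
  · intro C hC
    simp only [Finset.mem_filter] at hC
    exact Finset.sdiff_union_of_subset hC.2.1
  · intro D hD
    rw [Finset.mem_powerset] at hD
    rw [Finset.card_union_of_disjoint]
    rw [Finset.disjoint_left]
    intro x hx hxA
    have := hD hx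
    simp [hxA] at this

lemma shapley_eq_sum_shapleyWeight {V : Type*} [Fintype V] [DecidableEq V]
    (G : SimpleGraph V) (v : V) :
    shapley G v = ∑ C ∈ (Finset.univ.erase v).powerset,
      shapleyWeight (#(Finset.univ.erase v) + 1) #C *
        |((betti G (insert v C) : ℝ)) - ((betti G C : ℝ))| := by
  rw [Finset.card_erase_add_one (Finset.mem_univ v)]
  rfl

lemma shapley_wheelGraph_none {m : ℕ} [NeZero m] (hm : 3 ≤ m) :
    shapley (wheelGraph m) none = (m : ℝ) / 6 - 1 + 3 / (m + 1) := by
  set S : Finset (Option (Fin m)) := univ.erase none with hS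
  have hcardS : #S = m := by simp [hS]
  have key : ∀ C ∈ S.powerset,
      |((betti (wheelGraph m) (insert none C) : ℝ)) - ((betti (wheelGraph m) C : ℝ))| =
      (∑ i : Fin m, cylinder {some i} {some (i + 1)} C) - cylinder ∅ ∅ C
        + 2 * cylinder ∅ S C + cylinder S ∅ C := by
    intro C hC
    rw [Finset.mem_powerset] at hC
    have h0 : none ∉ C := fun h => by simpa [hS] using hC h
    rw [betti_wheelGraph_of_none_mem (Finset.mem_insert_self _ _)]
    by_cases hp : ∃ j : Fin m, some j ∉ C
    · have hSC : ¬ S ⊆ C := fun h => by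
        obtain ⟨j, hj⟩ := hp
        exact hj (h (by simp [hS]))
      have hf : (∑ i : Fin m, cylinder {some i} {some (i + 1)} C) = betti (wheelGraph m) C := by
        rw [betti_wheelGraph_of_proper (by omega) h0 hp]
        simp [cylinder]
      rw [hf]
      rcases C.eq_empty_or_nonempty with rfl | hne
      · simp [cylinder, betti_empty, hSC]
        norm_num
      · have hd : ¬ Disjoint S C := fun h => by
          obtain ⟨x, hx⟩ := hne
          exact Finset.disjoint_left.1 h (hC hx) hx
        have h1 : (1 : ℝ) ≤ betti (wheelGraph m) C := by
          have : Nonempty (↑C : Set (Option (Fin m))) := hne.to_subtype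
          have : 0 < betti (wheelGraph m) C := Nat.card_pos
          exact_mod_cast this
        rw [abs_of_nonpos (by push_cast; linarith)]
        simp [cylinder, hd, hSC]
    · push Not at hp
      have : C = S := by
        ext (_ | i)
        · simp [hS, h0]
        · simp [hS, hp]
      subst this
      have hd : S ≠ ∅ := Finset.ne_empty_of_mem (hp 0)
      rw [hS, betti_wheelGraph_periphery (by omega)]
      simp [cylinder, ← hS, hd, hp]
  rw [shapley_eq_sum_shapleyWeight, ← hS,
    Finset.sum_congr rfl fun C hC => congrArg (shapleyWeight (#S + 1) #C * ·) (key C hC)]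
  simp only [mul_add, mul_sub, Finset.sum_add_distrib, Finset.sum_sub_distrib, Finset.mul_sum,
    mul_left_comm _ (2 : ℝ)]
  rw [Finset.sum_comm, ← Finset.mul_sum,
    sum_shapleyWeight_mul_cylinder (by simp) (by simp) (by simp),
    sum_shapleyWeight_mul_cylinder (by simp) subset_rfl (by simp),
    sum_shapleyWeight_mul_cylinder subset_rfl (by simp) (by simp),
    Finset.sum_congr rfl fun i _ => sum_shapleyWeight_mul_cylinder (S := S) (A := {some i})
      (B := {some (i + 1)}) (by simp [hS]) (by simp [hS])
      (by simpa using Fin.self_ne_add_one (by omega) i)]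
  simp only [hcardS, shapleyWeight, Finset.card_singleton, Finset.card_empty, Finset.sum_const,
    Finset.card_univ, Fintype.card_fin, nsmul_eq_mul, Nat.factorial_succ, zero_add, add_zero,
    Nat.add_sub_cancel_left, Nat.add_sub_cancel, Nat.sub_zero]
  have := Nat.factorial_ne_zero m
  norm_num [Nat.factorial]
  field_simp
  ring

/-- Adding a periphery vertex to a proper part of the periphery without filling it up. -/
lemma betti_wheelGraph_insert_sub {m : ℕ} [NeZero m] (hm : 3 ≤ m) (v : Fin m)
    {C : Finset (Option (Fin m))} (h0 : none ∉ C) (hv : some v ∉ C)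
    (hp : ∃ j : Fin m, some j ∉ insert (some v) C) :
    (betti (wheelGraph m) (insert (some v) C) : ℝ) - betti (wheelGraph m) C =
      1 - (if some (v + 1) ∈ C then 1 else 0) - (if some (v - 1) ∈ C then 1 else 0) := by
  rw [betti_wheelGraph_of_proper (by omega) (by simpa using h0) hp,
    betti_wheelGraph_of_proper (by omega) h0 ⟨v, hv⟩, Finset.card_filter, Finset.card_filter]
  push_cast
  rw [← Finset.sum_sub_distrib]
  have h1 : v + 1 ≠ v := (Fin.self_ne_add_one (by omega) v).symm
  have h2 : v - 1 ≠ v := fun h => h1 (sub_eq_iff_eq_add.1 h).symm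
  rw [← Finset.sum_subset (Finset.subset_univ {v, v - 1}), Finset.sum_pair h2.symm]
  · simp only [Finset.mem_insert, Option.some.injEq, sub_add_cancel, h1, h2, hv]
    split_ifs <;> simp_all
  · intro i _ hi
    simp only [Finset.mem_insert, Finset.mem_singleton, not_or, eq_sub_iff_add_eq] at hi
    simp [hi.1, hi.2]

lemma Fin.add_one_ne_sub_one {m : ℕ} [NeZero m] (hm : 3 ≤ m) (v : Fin m) : v + 1 ≠ v - 1 := by
  intro h
  have h1 : (1 : Fin m) + 1 = 0 := by
    have h3 : v + 1 + 1 = v := eq_sub_iff_add_eq.1 h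
    rw [add_assoc] at h3
    simpa using h3
  have h2 := congrArg Fin.val h1
  rw [Fin.val_add, Fin.val_one', Nat.mod_eq_of_lt (show 1 < m by omega),
    Nat.mod_eq_of_lt (by omega)] at h2
  simp at h2

lemma shapley_wheelGraph_some {m : ℕ} [NeZero m] (hm : 3 ≤ m) (v : Fin m) :
    shapley (wheelGraph m) (some v) = 1 / 3 - 1 / ((m : ℝ) * (m + 1)) := by
  set S : Finset (Option (Fin m)) := univ.erase (some v) with hS
  have hcardS : #S = m := by simp [hS]
  have hnone : none ∈ S := by simp [hS]
  have hcardT : #(S.erase none) = m - 1 := by rw [Finset.card_erase_of_mem hnone, hcardS]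
  have hne := Fin.add_one_ne_sub_one hm v
  have h1 : v + 1 ≠ v := (Fin.self_ne_add_one (by omega) v).symm
  have h2 : v - 1 ≠ v := fun h => h1 (sub_eq_iff_eq_add.1 h).symm
  have key : ∀ C ∈ S.powerset,
      |((betti (wheelGraph m) (insert (some v) C) : ℝ)) - ((betti (wheelGraph m) C : ℝ))| =
      cylinder ∅ {none, some (v + 1), some (v - 1)} C
        + cylinder {some (v + 1), some (v - 1)} {none} C - cylinder (S.erase none) {none} C := by
    intro C hC
    rw [Finset.mem_powerset] at hC
    have hv : some v ∉ C := fun h => by simpa [hS] using hC h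
    by_cases h0 : none ∈ C
    · rw [betti_wheelGraph_of_none_mem h0,
        betti_wheelGraph_of_none_mem (Finset.mem_insert_of_mem h0)]
      simp [cylinder, h0]
    · by_cases hp : ∃ j : Fin m, some j ∉ insert (some v) C
      · have hSC : ¬ S.erase none ⊆ C := fun h => by
          obtain ⟨j, hj⟩ := hp
          rw [Finset.mem_insert, not_or] at hj
          exact hj.2 (h (by simpa [hS] using hj.1))
        rw [betti_wheelGraph_insert_sub hm v h0 hv hp]
        by_cases ha : some (v + 1) ∈ C <;> by_cases hb : some (v - 1) ∈ C <;>
          simp [cylinder, h0, hSC, ha, hb, Finset.insert_subset_iff]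
      · push Not at hp
        have hp' : ∀ j, j ≠ v → some j ∈ C := fun j hj => by simpa [hj] using hp j
        have hins : insert (some v) C = univ.erase none := by
          ext (_ | i)
          · simp [h0]
          · simpa using hp i
        have hSC : S.erase none ⊆ C := by
          rintro (_ | i) hi
          · simp at hi
          · exact hp' i (by simpa [hS] using hi)
        have hends : ({i : Fin m | some i ∈ C ∧ some (i + 1) ∉ C} : Finset (Fin m)) = {v - 1} := by
          ext i
          simp only [Finset.mem_filter, Finset.mem_univ, true_and, Finset.mem_singleton,
            eq_sub_iff_add_eq]
          constructor
          · intro h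
            by_contra hi
            exact h.2 (hp' _ hi)
          · intro h
            rw [h]
            exact ⟨hp' i (by rintro rfl; exact h1 h), hv⟩
        rw [hins, betti_wheelGraph_periphery (by omega),
          betti_wheelGraph_of_proper (by omega) h0 ⟨v, hv⟩, hends]
        simp [cylinder, h0, hSC, hp' _ h1, hp' _ h2, Finset.insert_subset_iff]
  rw [shapley_eq_sum_shapleyWeight, ← hS,
    Finset.sum_congr rfl fun C hC => congrArg (shapleyWeight (#S + 1) #C * ·) (key C hC)]
  simp only [mul_add, mul_sub, Finset.sum_add_distrib, Finset.sum_sub_distrib]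
  rw [sum_shapleyWeight_mul_cylinder (by simp) (by simp [hS, Finset.insert_subset_iff, h1, h2])
      (by simp),
    sum_shapleyWeight_mul_cylinder (by simp [hS, Finset.insert_subset_iff, h1, h2])
      (by simp [hS]) (by simp),
    sum_shapleyWeight_mul_cylinder (Finset.erase_subset _ _) (by simp [hS]) (by simp), hcardT]
  have hc2 : #{some (v + 1), some (v - 1)} = 2 := Finset.card_pair (by simpa using hne)
  have hc3 : #{none, some (v + 1), some (v - 1)} = 3 := by
    rw [Finset.card_insert_of_notMem (by simp), hc2]
  rw [hc2, hc3]
  obtain ⟨k, rfl⟩ : ∃ k, m = k + 1 := ⟨m - 1, by omega⟩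
  have := Nat.factorial_ne_zero k
  simp only [shapleyWeight, Finset.card_singleton, Finset.card_empty, Nat.add_sub_cancel,
    Nat.factorial_succ, show k + 1 + 1 - k - 1 = 1 by omega]
  norm_num [Nat.factorial]
  field_simp

/-- For the wheel graph `W_n` on `n ≥ 4` vertices, the normalized influence
score of every periphery vertex equals `2(n² − n − 3)/(3(n−1)(n² − 3n + 4))`
and the normalized influence score of the center equals
`(n² − 7n + 18)/(3(n² − 3n + 4))`. -/
theorem influence_wheelGraph (n : ℕ) (hn : 4 ≤ n) :
    (∀ v : Fin (n - 1), influence (wheelGraph (n - 1)) (some v) =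
      2 * ((n : ℝ) ^ 2 - (n : ℝ) - 3) /
        (3 * ((n : ℝ) - 1) * ((n : ℝ) ^ 2 - 3 * (n : ℝ) + 4))) ∧
    influence (wheelGraph (n - 1)) none =
      ((n : ℝ) ^ 2 - 7 * (n : ℝ) + 18) / (3 * ((n : ℝ) ^ 2 - 3 * (n : ℝ) + 4)) := by
  obtain ⟨m, rfl⟩ : ∃ m, n = m + 1 := ⟨n - 1, by omega⟩
  have hm : 3 ≤ m := by omega
  have : NeZero m := ⟨by omega⟩
  change (∀ v : Fin m, influence (wheelGraph m) (some v) = _) ∧ influence (wheelGraph m) none = _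
  have hm0 : (0 : ℝ) < m := by exact_mod_cast (show 0 < m by omega)
  have hpos : (0 : ℝ) < (m : ℝ) ^ 2 - m + 2 := by nlinarith [sq_nonneg ((m : ℝ) - 1)]
  have htot : ∑ u, shapley (wheelGraph m) u = ((m : ℝ) ^ 2 - m + 2) / (2 * (m + 1)) := by
    rw [Fintype.sum_option, shapley_wheelGraph_none hm]
    simp only [shapley_wheelGraph_some hm, Finset.sum_const, Finset.card_univ, Fintype.card_fin,
      nsmul_eq_mul]
    field_simp
    ring
  have hden : ((m + 1 : ℕ) : ℝ) ^ 2 - 3 * ((m + 1 : ℕ) : ℝ) + 4 = (m : ℝ) ^ 2 - m + 2 := by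
    push_cast
    ring
  have hm1 : ((m + 1 : ℕ) : ℝ) - 1 = m := by
    push_cast
    ring
  rw [hden, hm1]
  unfold influence
  rw [htot]
  refine ⟨fun v => ?_, ?_⟩
  · rw [shapley_wheelGraph_some hm]
    push_cast
    field_simp
    ring
  · rw [shapley_wheelGraph_none hm]
    push_cast
    field_simp
    ring
end
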